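/- (Partial trace formula for extremal weight projectors) For every m ≥ 2: (id^{⊗(m−1)} ⊗ cap) ∘ (t_m ⊗ id_V) ∘ (id^{⊗(m−1)} ⊗ cup) = −t_{m−1} in End(V^{⊗(m−1)}); and for m = 1: cap ∘ (t₁ ⊗ id_V) ∘ cup = −2 · id_ℂ. -/

import Mathlib

open Matrix

noncomputable section

/-- Sign strings `ε ∈ {+,-}^m`; `true` encodes `+` and `false` encodes `-`. -/
abbrev Sgn (m : ℕ) := Fin m → Bool

/-- Endomorphisms of `V^{⊗m}` (`V = ℂ²`), as matrices indexed by sign strings. -/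
abbrev Op (m : ℕ) := Matrix (Sgn m) (Sgn m) ℂ

/-- Linear maps `V^{⊗m} → V^{⊗n}`, as matrices (rows: target, columns: source). -/
abbrev Mor (m n : ℕ) := Matrix (Sgn n) (Sgn m) ℂ

/-- The basis vector `v_ε` of `V^{⊗m}`. -/
def bv {m : ℕ} (ε : Sgn m) : Sgn m → ℂ := fun δ => if δ = ε then 1 else 0

/-- The coefficient of `cap` on `v_a ⊗ v_b`:
`cap (v₋ ⊗ v₊) = 1`, `cap (v₊ ⊗ v₋) = -1`, `cap (v₊ ⊗ v₊) = cap (v₋ ⊗ v₋) = 0`. -/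
def capc (a b : Bool) : ℂ := if a then (if b then 0 else -1) else (if b then 1 else 0)

/-- The coefficient of `v_a ⊗ v_b` in `cup 1 = v₊ ⊗ v₋ - v₋ ⊗ v₊`. -/
def cupc (a b : Bool) : ℂ := if a then (if b then 0 else 1) else (if b then -1 else 0)

/-- The cap `V ⊗ V → ℂ`. -/
def capM : Mor 2 0 := Matrix.of fun _ ε => capc (ε 0) (ε 1)

/-- The cup `ℂ → V ⊗ V`. -/
def cupM : Mor 0 2 := Matrix.of fun δ _ => cupc (δ 0) (δ 1)

/-- The tensor product of two linear maps. -/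
def tensMor {a b c d : ℕ} (A : Mor a b) (B : Mor c d) : Mor (a + c) (b + d) :=
  Matrix.of fun δ ε =>
    A (fun i => δ (Fin.castAdd d i)) (fun i => ε (Fin.castAdd c i)) *
      B (fun j => δ (Fin.natAdd b j)) (fun j => ε (Fin.natAdd a j))

/-- The swap of the two tensor factors of `V ⊗ V`. -/
def swap2 : Op 2 := Matrix.of fun δ ε => if δ 0 = ε 1 ∧ δ 1 = ε 0 then 1 else 0

/-- `id^{⊗p} ⊗ A ⊗ id^{⊗(m-p-2)}`: the operator `A` on two strands placed at the
(0-based) positions `p`, `p+1` among `m` strands. -/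
def atPos (m p : ℕ) (A : Op 2) : Op m :=
  Matrix.of fun δ ε =>
    if h : p + 2 ≤ m then
      (if ∀ k : Fin m, k.val ≠ p → k.val ≠ p + 1 → δ k = ε k then 1 else 0) *
        A (fun i => δ ⟨p + i.val, Nat.lt_of_lt_of_le (Nat.add_lt_add_left i.isLt p) h⟩)
          (fun i => ε ⟨p + i.val, Nat.lt_of_lt_of_le (Nat.add_lt_add_left i.isLt p) h⟩)
    else 0

/-- Cyclic rotation of sign strings: `(rotIdx δ) k = δ (k+1 mod m)`. -/
def rotIdx {m : ℕ} (δ : Sgn m) : Sgn m := fun k => δ ⟨(k.val + 1) % m, Nat.mod_lt _ k.pos⟩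

/-- The rotation `d_m : V^{⊗m} → V^{⊗m}`, `d_m (v_ε ⊗ w) = i^{ε} (w ⊗ v_ε)`. -/
def dRot : (m : ℕ) → Op m
  | 0 => 1
  | (m + 1) =>
    Matrix.of fun δ' δ =>
      if δ' = rotIdx δ then (if δ 0 then Complex.I else -Complex.I) else 0

/-- The cap-cup generator `u_j` (`j` is 1-based, `1 ≤ j ≤ m-1`);
`u_0 := d_m⁻¹ ∘ u_1 ∘ d_m` is the affine generator. -/
def uFull (m j : ℕ) : Op m :=
  if j = 0 then (dRot m)⁻¹ * atPos m 0 (cupM * capM) * dRot m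
  else atPos m (j - 1) (cupM * capM)

/-- The extremal weight projectors `t_m`, defined by `t₁ = id`,
`t₂ = id + u₁/2 + u₀/2`, and `t_{m+1} = (t_m ⊗ id) ∘ σ_m ∘ (t_m ⊗ id)` for `m ≥ 2`
(with the convention `t₀ = 2·id`). -/
def tP : (m : ℕ) → Op m
  | 0 => (2 : ℂ) • 1
  | 1 => 1
  | 2 => 1 + (2⁻¹ : ℂ) • atPos 2 0 (cupM * capM) +
      (2⁻¹ : ℂ) • ((dRot 2)⁻¹ * atPos 2 0 (cupM * capM) * dRot 2)
  | (m + 3) =>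
    tensMor (tP (m + 2)) (1 : Op 1) * atPos (m + 3) (m + 1) swap2 *
      tensMor (tP (m + 2)) (1 : Op 1)

/-- `n` nested caps `Ca_n : V^{⊗2n} → ℂ`. -/
def CaM (n : ℕ) : Mor (n + n) 0 :=
  Matrix.of fun _ δ =>
    ∏ k : Fin n,
      capc (δ ⟨k.val, Nat.lt_of_lt_of_le k.isLt (Nat.le_add_right n n)⟩)
        (δ ⟨n + n - 1 - k.val,
          Nat.lt_of_le_of_lt (Nat.sub_le _ _)
            (Nat.sub_lt (Nat.lt_of_lt_of_le k.pos (Nat.le_add_right n n)) Nat.one_pos)⟩)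

/-- `n` nested cups `Cu_n : ℂ → V^{⊗2n}`. -/
def CuM (n : ℕ) : Mor 0 (n + n) :=
  Matrix.of fun δ _ =>
    ∏ k : Fin n,
      cupc (δ ⟨k.val, Nat.lt_of_lt_of_le k.isLt (Nat.le_add_right n n)⟩)
        (δ ⟨n + n - 1 - k.val,
          Nat.lt_of_le_of_lt (Nat.sub_le _ _)
            (Nat.sub_lt (Nat.lt_of_lt_of_le k.pos (Nat.le_add_right n n)) Nat.one_pos)⟩)

/-- The canonical identification of sign strings induced by an equality of lengths. -/
def sgnCast {a b : ℕ} (h : a = b) : Sgn a ≃ Sgn b :=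
  Equiv.arrowCongr (finCongr h) (Equiv.refl Bool)

/-- Reindexing of a linear map along equalities of the numbers of strands. -/
def rc {a b c d : ℕ} (h1 : a = b) (h2 : c = d) (A : Mor a c) : Mor b d :=
  Matrix.reindex (sgnCast h2) (sgnCast h1) A

/-- The idempotents `e_{m,n}`:
`e_{1,1} = -u₁/2 - d₂⁻¹ ∘ u₁ ∘ d₂ / 2` and
`e_{m,n} = -(t_m ⊗ t_n) ∘ u_m ∘ (t_m ⊗ t_n)` otherwise. -/
def eP : (m n : ℕ) → Op (m + n)
  | 1, 1 =>
    (-(2⁻¹ : ℂ)) • atPos 2 0 (cupM * capM) +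
      (-(2⁻¹ : ℂ)) • ((dRot 2)⁻¹ * atPos 2 0 (cupM * capM) * dRot 2)
  | m, n =>
    -(tensMor (tP m) (tP n) * atPos (m + n) (m - 1) (cupM * capM) * tensMor (tP m) (tP n))

/-- The projector onto the extremal weight vectors `v_{+⋯+}` and `v_{-⋯-}`. -/
def extremalProj (m : ℕ) : Op m :=
  Matrix.diagonal fun δ => if ∀ i j, δ i = δ j then 1 else 0

lemma tensMor_diagonal_one {m n : ℕ} (d : Sgn m → ℂ) :
    tensMor (Matrix.diagonal d) (1 : Op n) =
      Matrix.diagonal fun δ : Sgn (m + n) => d fun i => δ (Fin.castAdd n i) := by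
  ext δ ε
  have h : δ = ε ↔ (fun i => δ (Fin.castAdd n i)) = (fun i => ε (Fin.castAdd n i)) ∧
      (fun j => δ (Fin.natAdd m j)) = fun j => ε (Fin.natAdd m j) := by
    constructor
    · rintro rfl
      exact ⟨rfl, rfl⟩
    · rintro ⟨h₁, h₂⟩
      funext i
      exact Fin.addCases (congrFun h₁) (congrFun h₂) i
  simp only [tensMor, Matrix.of_apply, Matrix.diagonal_apply, Matrix.one_apply, h]
  split_ifs <;> simp_all

lemma sum_sgn_two (f : Sgn 2 → ℂ) :
    ∑ ε, f ε = f ![true, true] + f ![true, false] + f ![false, true] + f ![false, false] := by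
  rw [← (finTwoArrowEquiv Bool).symm.sum_comp, Fintype.sum_prod_type]
  simp [finTwoArrowEquiv, add_assoc]

lemma sgn_two_eq (δ : Sgn 2) : δ = ![δ 0, δ 1] := by
  ext i
  fin_cases i <;> rfl

lemma rotIdx_two (a b : Bool) : rotIdx ![a, b] = ![b, a] := by
  ext i
  fin_cases i <;> rfl

lemma dRot_two_inv : (dRot 2)⁻¹ = (dRot 2)ᴴ := by
  refine Matrix.inv_eq_right_inv ?_
  ext δ ε
  rw [sgn_two_eq δ, sgn_two_eq ε, Matrix.mul_apply, sum_sgn_two]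
  generalize δ 0 = a, δ 1 = b, ε 0 = c, ε 1 = d
  simp only [dRot, Matrix.conjTranspose_apply, Matrix.of_apply, rotIdx_two, Matrix.one_apply]
  cases a <;> cases b <;> cases c <;> cases d <;> simp

lemma cup_cap_apply (δ ε : Sgn 2) :
    atPos 2 0 (cupM * capM) δ ε = cupc (δ 0) (δ 1) * capc (ε 0) (ε 1) := by
  simp [atPos, Matrix.mul_apply, cupM, capM]

lemma tP_two : tP 2 = extremalProj 2 := by
  rw [tP, dRot_two_inv]
  ext δ ε
  rw [sgn_two_eq δ, sgn_two_eq ε]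
  generalize δ 0 = a, δ 1 = b, ε 0 = c, ε 1 = d
  simp only [extremalProj, Matrix.add_apply, Matrix.smul_apply, Matrix.mul_apply, sum_sgn_two,
    cup_cap_apply, dRot, Matrix.conjTranspose_apply, Matrix.of_apply, rotIdx_two,
    Matrix.one_apply, Matrix.diagonal_apply, Fin.forall_fin_two]
  cases a <;> cases b <;> cases c <;> cases d <;> simp [cupc, capc] <;> norm_num

lemma extremalProj_succ (m : ℕ) :
    tensMor (extremalProj (m + 2)) (1 : Op 1) * atPos (m + 3) (m + 1) swap2 *
      tensMor (extremalProj (m + 2)) (1 : Op 1) = extremalProj (m + 3) := by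
  simp only [extremalProj, tensMor_diagonal_one]
  ext δ ε
  rw [Matrix.mul_diagonal, Matrix.diagonal_mul, Matrix.diagonal_apply]
  simp only [atPos, swap2, Matrix.of_apply, le_refl, dite_true]
  by_cases h : δ = ε ∧ ∀ i j, δ i = δ j
  · obtain ⟨rfl, h⟩ := h
    simp [h _ 0]
  · rw [← ite_and, if_neg h]
    contrapose! h
    simp only [ne_eq, mul_eq_zero, ite_eq_right_iff, one_ne_zero, imp_false, not_or,
      not_not] at h
    obtain ⟨⟨hδ, hk, h₁, h₂⟩, hε⟩ := h
    have hδε : δ 0 = ε 0 := hk 0 (by simp) (by simp)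
    have hδ₀ (i : ℕ) (hi : i < m + 2) : δ ⟨i, by omega⟩ = δ 0 := hδ ⟨i, hi⟩ 0
    have hε₀ (i : ℕ) (hi : i < m + 2) : ε ⟨i, by omega⟩ = ε 0 := hε ⟨i, hi⟩ 0
    have hδ₁ : δ ⟨m + 2, by omega⟩ = δ 0 := (h₂.trans (hε₀ (m + 1) (by omega))).trans hδε.symm
    have hε₁ : ε ⟨m + 2, by omega⟩ = ε 0 := (h₁.symm.trans (hδ₀ (m + 1) (by omega))).trans hδε
    have hδ₂ (i : Fin (m + 3)) : δ i = δ 0 := by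
      rcases Nat.lt_succ_iff_lt_or_eq.mp i.isLt with hi | hi
      · exact hδ₀ i hi
      · rwa [show i = ⟨m + 2, by omega⟩ from Fin.ext hi]
    have hε₂ (i : Fin (m + 3)) : ε i = ε 0 := by
      rcases Nat.lt_succ_iff_lt_or_eq.mp i.isLt with hi | hi
      · exact hε₀ i hi
      · rwa [show i = ⟨m + 2, by omega⟩ from Fin.ext hi]
    refine ⟨funext fun i => ?_, fun i j => (hδ₂ i).trans (hδ₂ j).symm⟩
    rw [hδ₂, hε₂, hδε]

theorem tP_succ : ∀ m : ℕ, tP (m + 1) = extremalProj (m + 1)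
  | 0 => by
    simp [tP, extremalProj]
  | 1 => tP_two
  | m + 2 => by
    rw [tP, tP_succ (m + 1), extremalProj_succ]

/-- The partial trace of an operator that is diagonal in the standard basis. -/
lemma partial_trace_diagonal (k : ℕ) (d : Sgn (k + 1) → ℂ) :
    tensMor (1 : Op k) capM * tensMor (Matrix.diagonal d) (1 : Op 1) * tensMor (1 : Op k) cupM =
      -(Matrix.diagonal fun α : Sgn k => d (Fin.snoc α true) + d (Fin.snoc α false)) := by
  rw [tensMor_diagonal_one]
  ext (α : Sgn k) (β : Sgn k)
  have hd (γ : Sgn k) (x : Sgn 2) :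
      (fun i : Fin (k + 1) => Fin.append γ x (Fin.castAdd 1 i)) = Fin.snoc γ (x 0) := by
    funext i
    refine Fin.lastCases ?_ (fun i => ?_) i
    · rw [Fin.snoc_last]
      exact Fin.append_right γ x 0
    · rw [Fin.snoc_castSucc]
      exact Fin.append_left γ x i
  rw [Matrix.mul_apply]
  simp only [Matrix.mul_diagonal]
  refine ((Fin.appendEquiv k 2).sum_comp _).symm.trans ?_
  simp only [Fintype.sum_prod_type, sum_sgn_two]
  simp [Fin.appendEquiv, tensMor, hd, capM, cupM, capc, cupc, Matrix.one_apply,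
    Matrix.diagonal_apply]
  change ∑ γ : Sgn k, ((if γ = β then -if α = γ then d (Fin.snoc γ true) else 0 else 0) +
    -if γ = β then if α = γ then d (Fin.snoc γ false) else 0 else 0) = _
  rw [Finset.sum_eq_single β (fun γ _ h => by simp [h]) (fun h => absurd (Finset.mem_univ β) h)]
  by_cases h : α = β
  · subst h
    simp [add_comm]
  · simp [h]

lemma partial_trace_extremalProj (k : ℕ) :
    tensMor (1 : Op (k + 1)) capM * tensMor (extremalProj (k + 2)) (1 : Op 1) *
      tensMor (1 : Op (k + 1)) cupM = -(extremalProj (k + 1)) := by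
  rw [extremalProj, partial_trace_diagonal, extremalProj]
  congr 2
  funext α
  have h (b : Bool) : (∀ i j : Fin (k + 2), (Fin.snoc α b : Sgn (k + 2)) i =
      (Fin.snoc α b : Sgn (k + 2)) j) ↔ (∀ i j, α i = α j) ∧ α 0 = b := by
    constructor
    · intro H
      exact ⟨fun i j => by simpa using H i.castSucc j.castSucc,
        by simpa using H (Fin.castSucc 0) (Fin.last _)⟩
    · rintro ⟨H, rfl⟩
      simp only [Fin.forall_fin_succ' (n := k + 1), Fin.snoc_castSucc, Fin.snoc_last]
      exact ⟨fun i => ⟨H i, H i 0⟩, H 0, trivial⟩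
  simp only [h]
  cases α 0 <;> simp

/-- Partial trace formula for extremal weight projectors:
for `m ≥ 2` (here `m = k + 1` with `k ≥ 1`),
`(id^{⊗(m-1)} ⊗ cap) ∘ (t_m ⊗ id) ∘ (id^{⊗(m-1)} ⊗ cup) = -t_{m-1}`; and
`cap ∘ (t₁ ⊗ id) ∘ cup = -2·id_ℂ`. -/
theorem tP_partial_trace :
    (∀ k : ℕ, 1 ≤ k →
      tensMor (1 : Op k) capM * tensMor (tP (k + 1)) (1 : Op 1) * tensMor (1 : Op k) cupM =
        -(tP k)) ∧
    capM * tensMor (tP 1) (1 : Op 1) * cupM = (-2 : ℂ) • (1 : Op 0) := by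
  refine ⟨fun k hk => ?_, ?_⟩
  · obtain ⟨k, rfl⟩ := Nat.exists_eq_add_of_le' hk
    rw [tP_succ, tP_succ, partial_trace_extremalProj]
  · have h : tensMor (1 : Op 1) (1 : Op 1) = (1 : Op (1 + 1)) := by
      simpa using tensMor_diagonal_one (n := 1) fun _ : Sgn 1 => 1
    rw [tP, h, Matrix.mul_one]
    ext α β
    rw [Matrix.mul_apply]
    refine (sum_sgn_two _).trans ?_
    simp [capM, cupM, capc, cupc, Subsingleton.elim α β]
    norm_num
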